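/- Let k be a field, F = k((t)), O = k[[t]], let m ≥ 0 be an integer, and let γ = [[0, t^{m+1}],[t^m, 0]] ∈ M₂(F) act on F². Let Λ be an O-lattice in F² with [Λ : O²] = 0. If m = 2p is even, then γΛ ⊆ Λ if and only if t^p·O² ⊆ Λ ⊆ t^{−p}·O². If m = 2p + 1 is odd, then γΛ ⊆ Λ if and only if t^{p+1}O ⊕ t^{p}O ⊆ Λ ⊆ t^{−p}O ⊕ t^{−p−1}O. -/

import Mathlib

open PowerSeries LaurentSeries

/-- The `k[[t]]`-submodule `t^a · k[[t]]` of the Laurent series field `k((t))`. -/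
noncomputable def tO (k : Type) [Field k] (a : ℤ) :
    Submodule (PowerSeries k) (LaurentSeries k) :=
  Submodule.span (PowerSeries k) {(HahnSeries.single a 1 : LaurentSeries k)}

/-- The lattice `t^{a 0} O ⊕ ⋯ ⊕ t^{a (n-1)} O` in `F^n`. -/
noncomputable def diagLat (k : Type) [Field k] {n : ℕ} (a : Fin n → ℤ) :
    Submodule (PowerSeries k) (Fin n → LaurentSeries k) :=
  Submodule.pi Set.univ fun i => tO k (a i)

/-- The standard lattice `O^n`. -/
noncomputable def stdLat (k : Type) [Field k] (n : ℕ) :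
    Submodule (PowerSeries k) (Fin n → LaurentSeries k) :=
  diagLat k fun _ : Fin n => 0

/-- An `O = k[[t]]`-lattice in `F^n = k((t))^n`: a finitely generated `O`-submodule
spanning `F^n` over `F`. -/
def IsLattice {k : Type} [Field k] {n : ℕ}
    (Λ : Submodule (PowerSeries k) (Fin n → LaurentSeries k)) : Prop :=
  Λ.FG ∧ Submodule.span (LaurentSeries k) (Λ : Set (Fin n → LaurentSeries k)) = ⊤

/-- The `k`-dimension of `N/(N ⊓ P)`. -/
noncomputable def qdim {k : Type} [Field k] {V : Type} [AddCommGroup V]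
    [Module (PowerSeries k) V] (N P : Submodule (PowerSeries k) V) : ℕ :=
  letI := Module.compHom (↥N ⧸ Submodule.comap N.subtype (N ⊓ P))
    (algebraMap k (PowerSeries k))
  Module.finrank k (↥N ⧸ Submodule.comap N.subtype (N ⊓ P))

/-- The relative length `[Λ₁ : Λ₂] = dim_k Λ₁/(Λ₁∩Λ₂) − dim_k Λ₂/(Λ₁∩Λ₂)`. -/
noncomputable def relIdx {k : Type} [Field k] {V : Type} [AddCommGroup V]
    [Module (PowerSeries k) V] (A B : Submodule (PowerSeries k) V) : ℤ :=
  (qdim A B : ℤ) - (qdim B A : ℤ)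

section Auxiliary

variable {k : Type} [Field k]

theorem qdim_eq_card {V ι : Type} [AddCommGroup V] [Module (PowerSeries k) V] [Fintype ι]
    {N P : Submodule (PowerSeries k) V} (f : V →+ (ι → k))
    (hsmul : ∀ (c : k) (v : V), f (algebraMap k (PowerSeries k) c • v) = c • f v)
    (hsurj : ∀ w, ∃ v ∈ N, f v = w) (hker : ∀ v ∈ N, f v = 0 ↔ v ∈ P) :
    qdim N P = Fintype.card ι := by
  unfold qdim
  let : Module k (↥N ⧸ Submodule.comap N.subtype (N ⊓ P)) :=
    Module.compHom (↥N ⧸ Submodule.comap N.subtype (N ⊓ P)) (algebraMap k (PowerSeries k))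
  let φ : (↥N ⧸ Submodule.comap N.subtype (N ⊓ P)) →+ (ι → k) :=
    QuotientAddGroup.lift (Submodule.comap N.subtype (N ⊓ P)).toAddSubgroup
      (f.comp N.subtype.toAddMonoidHom) (fun x hx => (hker x x.2).2 hx.2)
  have hφ : ∀ x : N, φ (Submodule.Quotient.mk x) = f x := fun x => rfl
  let ψ : (↥N ⧸ Submodule.comap N.subtype (N ⊓ P)) →ₗ[k] (ι → k) :=
    { φ with
      map_smul' := by
        intro c q
        obtain ⟨x, rfl⟩ := Submodule.Quotient.mk_surjective _ q
        change φ (Submodule.Quotient.mk (algebraMap k (PowerSeries k) c • x)) = c • φ _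
        rw [hφ, hφ, ← hsmul]
        rfl }
  have hψ : ∀ x : N, ψ (Submodule.Quotient.mk x) = f x := fun x => rfl
  have hinj : Function.Injective ψ := by
    rw [injective_iff_map_eq_zero]
    intro q hq
    obtain ⟨x, rfl⟩ := Submodule.Quotient.mk_surjective _ q
    rw [hψ] at hq
    exact (Submodule.Quotient.mk_eq_zero _).2 ⟨x.2, (hker x x.2).1 hq⟩
  have hsur : Function.Surjective ψ := by
    intro w
    obtain ⟨v, hv, rfl⟩ := hsurj w
    exact ⟨Submodule.Quotient.mk ⟨v, hv⟩, rfl⟩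
  rw [(LinearEquiv.ofBijective ψ ⟨hinj, hsur⟩).finrank_eq, Module.finrank_fintype_fun_eq_card]

theorem mem_tO_iff_exists {a : ℤ} {v : LaurentSeries k} :
    v ∈ tO k a ↔ ∃ f : PowerSeries k,
      HahnSeries.single a 1 * HahnSeries.ofPowerSeries ℤ k f = v := by
  rw [tO, Submodule.mem_span_singleton]
  refine exists_congr fun f => ?_
  rw [Algebra.smul_def, mul_comm]
  rfl

theorem coeff_single_mul_ofPowerSeries_add (a : ℤ) (n : ℕ) (f : PowerSeries k) :
    (HahnSeries.single a (1 : k) * HahnSeries.ofPowerSeries ℤ k f).coeff (a + n) =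
      PowerSeries.coeff n f := by
  rw [add_comm, HahnSeries.coeff_single_mul_add, one_mul]
  exact LaurentSeries.coeff_coe_powerSeries f n

theorem mem_tO_iff {a : ℤ} {v : LaurentSeries k} :
    v ∈ tO k a ↔ ∀ n < a, v.coeff n = 0 := by
  rw [mem_tO_iff_exists]
  constructor
  · rintro ⟨f, rfl⟩ n hn
    rw [← sub_add_cancel n a, HahnSeries.coeff_single_mul_add, one_mul]
    have := PowerSeries.coeff_coe f (n - a)
    rw [if_pos (by omega)] at this
    exact this
  · intro h
    refine ⟨PowerSeries.mk fun n => v.coeff (a + n), ?_⟩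
    ext n
    by_cases hn : n < a
    · rw [h n hn, ← sub_add_cancel n a, HahnSeries.coeff_single_mul_add, one_mul]
      have := PowerSeries.coeff_coe (PowerSeries.mk fun n => v.coeff (a + n)) (n - a)
      rw [if_pos (by omega)] at this
      exact this
    · obtain ⟨j, rfl⟩ := Int.le.dest (not_lt.1 hn)
      rw [coeff_single_mul_ofPowerSeries_add, PowerSeries.coeff_mk]

theorem tO_antitone : Antitone (tO k) := fun _ _ h _ hv =>
  mem_tO_iff.2 fun n hn => mem_tO_iff.1 hv n (hn.trans_le h)

theorem single_mul_mem_tO_iff {a b c : ℤ} (h : c = b + a) {v : LaurentSeries k} :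
    HahnSeries.single b 1 * v ∈ tO k c ↔ v ∈ tO k a := by
  subst h
  rw [mem_tO_iff, mem_tO_iff]
  constructor
  · intro h n hn
    have := h (n + b) (by omega)
    rwa [HahnSeries.coeff_single_mul_add, one_mul] at this
  · intro h n hn
    rw [← sub_add_cancel n b, HahnSeries.coeff_single_mul_add, one_mul]
    exact h _ (by omega)

theorem mem_diagLat {n : ℕ} {a : Fin n → ℤ} {v : Fin n → LaurentSeries k} :
    v ∈ diagLat k a ↔ ∀ i, v i ∈ tO k (a i) := by
  simp [diagLat, Submodule.mem_pi]

theorem diagLat_mono {n : ℕ} {a b : Fin n → ℤ} (h : b ≤ a) : diagLat k a ≤ diagLat k b :=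
  fun _ hv => mem_diagLat.2 fun i => tO_antitone (h i) (mem_diagLat.1 hv i)

theorem coeff_algebraMap_smul (c : k) (v : LaurentSeries k) (n : ℤ) :
    (algebraMap k (PowerSeries k) c • v).coeff n = c * v.coeff n := by
  rw [Algebra.smul_def, ← PowerSeries.C_eq_algebraMap, LaurentSeries.coe_algebraMap,
    HahnSeries.ofPowerSeries_C, HahnSeries.C_mul_eq_smul, HahnSeries.coeff_smul, smul_eq_mul]

/-- The coefficients of `v i` in degrees `a i ≤ j < c i`. -/
noncomputable def windowCoeff (k : Type) [Field k] {n : ℕ} (a c : Fin n → ℤ) :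
    (Fin n → LaurentSeries k) →+ ((Σ i, Fin (c i - a i).toNat) → k) where
  toFun v s := (v s.1).coeff (a s.1 + (s.2 : ℕ))
  map_zero' := by ext; simp
  map_add' := by intros; ext; simp

theorem qdim_map_diagLat {n : ℕ} (a c : Fin n → ℤ)
    (g : (Fin n → LaurentSeries k) ≃ₗ[PowerSeries k] (Fin n → LaurentSeries k)) :
    qdim ((diagLat k a).map g.toLinearMap) ((diagLat k c).map g.toLinearMap) =
      ∑ i, (c i - a i).toNat := by
  rw [qdim_eq_card ((windowCoeff k a c).comp g.symm.toLinearMap.toAddMonoidHom)]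
  · simp
  · intro r v
    ext s
    change ((g.symm (algebraMap k (PowerSeries k) r • v)) s.1).coeff _ = r * (g.symm v s.1).coeff _
    rw [map_smul, Pi.smul_apply, coeff_algebraMap_smul]
  · intro w
    let u : Fin n → LaurentSeries k := fun i => HahnSeries.single (a i) 1 *
      HahnSeries.ofPowerSeries ℤ k (PowerSeries.mk fun j =>
        if h : j < (c i - a i).toNat then w ⟨i, j, h⟩ else 0)
    refine ⟨g u, Submodule.mem_map_of_mem
      (mem_diagLat.2 fun i => mem_tO_iff_exists.2 ⟨_, rfl⟩), ?_⟩
    ext ⟨i, j, hj⟩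
    change (g.symm (g u) i).coeff (a i + (j : ℕ)) = _
    rw [LinearEquiv.symm_apply_apply, coeff_single_mul_ofPowerSeries_add, PowerSeries.coeff_mk,
      dif_pos hj]
  · rintro _ ⟨v, hv, rfl⟩
    have hiff : g.toLinearMap v ∈ (diagLat k c).map g.toLinearMap ↔ v ∈ diagLat k c :=
      ⟨fun ⟨u, hu, h⟩ => g.injective h ▸ hu, fun h => ⟨v, h, rfl⟩⟩
    rw [hiff, mem_diagLat]
    have hval : ∀ s, (windowCoeff k a c).comp g.symm.toLinearMap.toAddMonoidHom
        (g.toLinearMap v) s = (v s.1).coeff (a s.1 + (s.2 : ℕ)) := by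
      intro s
      change (g.symm (g v) s.1).coeff _ = _
      rw [LinearEquiv.symm_apply_apply]
    rw [funext_iff]
    simp only [hval, Pi.zero_apply]
    constructor
    · intro h i
      rw [mem_tO_iff]
      intro l hl
      by_cases hla : l < a i
      · exact mem_tO_iff.1 (mem_diagLat.1 hv i) l hla
      · obtain ⟨j, rfl⟩ := Int.le.dest (not_lt.1 hla)
        exact h ⟨i, j, by omega⟩
    · rintro h ⟨i, j, hj⟩
      exact mem_tO_iff.1 (h i) _ (by change a i + (j : ℤ) < c i; omega)

theorem relIdx_map_diagLat {n : ℕ} (a c : Fin n → ℤ)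
    (g : (Fin n → LaurentSeries k) ≃ₗ[PowerSeries k] (Fin n → LaurentSeries k)) :
    relIdx ((diagLat k a).map g.toLinearMap) ((diagLat k c).map g.toLinearMap) =
      ∑ i, (c i - a i) := by
  rw [relIdx, qdim_map_diagLat, qdim_map_diagLat]
  push_cast
  rw [← Finset.sum_sub_distrib]
  refine Finset.sum_congr rfl fun i _ => ?_
  omega

/-- The chain of lattices stable under the Iwahori subgroup of `GL₂(O)`: under the identification
of `F²` with `k((s))`, `s² = t`, this is the filtration by the order in `s`. -/
noncomputable def iwahoriChain (k : Type) [Field k] (j : ℤ) :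
    Submodule (PowerSeries k) (Fin 2 → LaurentSeries k) :=
  diagLat k ![(j + 1) / 2, j / 2]

theorem mem_iwahoriChain {j : ℤ} {v : Fin 2 → LaurentSeries k} :
    v ∈ iwahoriChain k j ↔ v 0 ∈ tO k ((j + 1) / 2) ∧ v 1 ∈ tO k (j / 2) := by
  simp [iwahoriChain, mem_diagLat, Fin.forall_fin_two]

theorem iwahoriChain_antitone : Antitone (iwahoriChain k) := by
  intro i j h v hv
  rw [mem_iwahoriChain] at hv ⊢
  exact ⟨tO_antitone (by omega) hv.1, tO_antitone (by omega) hv.2⟩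

theorem exists_mem_tO (v : LaurentSeries k) : ∃ a, v ∈ tO k a :=
  ⟨v.order, mem_tO_iff.2 fun _ hn => HahnSeries.coeff_eq_zero_of_lt_order hn⟩

theorem exists_mem_iwahoriChain (v : Fin 2 → LaurentSeries k) : ∃ j, v ∈ iwahoriChain k j := by
  obtain ⟨a, ha⟩ := exists_mem_tO (v 0)
  obtain ⟨b, hb⟩ := exists_mem_tO (v 1)
  refine ⟨2 * min a b - 1, mem_iwahoriChain.2
    ⟨tO_antitone (by omega) ha, tO_antitone (by omega) hb⟩⟩

theorem exists_notMem_iwahoriChain {v : Fin 2 → LaurentSeries k} (hv : v ≠ 0) :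
    ∃ j, v ∉ iwahoriChain k j := by
  by_contra! h
  refine hv (funext fun i => ?_)
  ext n
  have := mem_iwahoriChain.1 (h (2 * n + 2))
  fin_cases i
  · exact mem_tO_iff.1 this.1 n (by omega)
  · exact mem_tO_iff.1 this.2 n (by omega)

theorem exists_mem_notMem_iwahoriChain {v : Fin 2 → LaurentSeries k} (hv : v ≠ 0) :
    ∃ j, v ∈ iwahoriChain k j ∧ v ∉ iwahoriChain k (j + 1) := by
  obtain ⟨b, hb⟩ := exists_notMem_iwahoriChain hv
  obtain ⟨j, hj, hmax⟩ := Int.exists_greatest_of_bdd (P := fun j => v ∈ iwahoriChain k j)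
    ⟨b, fun z hz => le_of_not_ge fun h => hb (iwahoriChain_antitone h hz)⟩
    (exists_mem_iwahoriChain v)
  exact ⟨j, hj, fun h => by have := hmax _ h; omega⟩

theorem exists_le_iwahoriChain {Λ : Submodule (PowerSeries k) (Fin 2 → LaurentSeries k)}
    (h : Λ.FG) : ∃ j, Λ ≤ iwahoriChain k j := by
  induction Λ, h using Submodule.fg_induction with
  | singleton v =>
    obtain ⟨j, hj⟩ := exists_mem_iwahoriChain v
    exact ⟨j, (Submodule.span_singleton_le_iff_mem _ _).2 hj⟩
  | sup M N _ _ hM hN =>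
    obtain ⟨i, hi⟩ := hM
    obtain ⟨j, hj⟩ := hN
    exact ⟨min i j, sup_le (hi.trans (iwahoriChain_antitone (min_le_left _ _)))
      (hj.trans (iwahoriChain_antitone (min_le_right _ _)))⟩

theorem mulVec_mem_iwahoriChain_iff {m : ℕ} {i j : ℤ} (h : i = j + 2 * m + 1)
    {v : Fin 2 → LaurentSeries k} :
    (Matrix.of ![![0, HahnSeries.single ((m : ℤ) + 1) 1],
      ![HahnSeries.single (m : ℤ) 1, 0]]).mulVec v ∈ iwahoriChain k i ↔
        v ∈ iwahoriChain k j := by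
  rw [mem_iwahoriChain, mem_iwahoriChain, and_comm]
  simp only [Matrix.mulVec, dotProduct, Fin.sum_univ_two, Matrix.of_apply, Matrix.cons_val_zero,
    Matrix.cons_val_one, zero_mul, zero_add, add_zero]
  rw [single_mul_mem_tO_iff (a := (j + 1) / 2) (by omega),
    single_mul_mem_tO_iff (a := j / 2) (by omega)]

/-- An invertible matrix over `O` acting on `F^n`. -/
noncomputable def integralEquiv {n : ℕ} (M : (Matrix (Fin n) (Fin n) (PowerSeries k))ˣ) :
    (Fin n → LaurentSeries k) ≃ₗ[PowerSeries k] (Fin n → LaurentSeries k) :=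
  let φ := (algebraMap (PowerSeries k) (LaurentSeries k)).mapMatrix (m := Fin n)
  (Matrix.toLin'OfInv (M := φ M⁻¹.1) (M' := φ M.1)
    (by rw [← map_mul, Units.inv_mul, map_one])
    (by rw [← map_mul, Units.mul_inv, map_one])).restrictScalars (PowerSeries k)

theorem integralEquiv_apply {n : ℕ} (M : (Matrix (Fin n) (Fin n) (PowerSeries k))ˣ)
    (v : Fin n → LaurentSeries k) (i : Fin n) :
    integralEquiv M v i = ∑ j, M.1 i j • v j := by
  simp only [Algebra.smul_def]
  change Matrix.toLin' _ v i = _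
  rw [Matrix.toLin'_apply]
  rfl

theorem integralEquiv_inv_apply {n : ℕ} (M : (Matrix (Fin n) (Fin n) (PowerSeries k))ˣ)
    (v : Fin n → LaurentSeries k) :
    integralEquiv M (integralEquiv M⁻¹ v) = v :=
  (integralEquiv M).apply_symm_apply v

theorem single_mul_ofPowerSeries_mem_tO_succ {a : ℤ} {f : PowerSeries k}
    (h : PowerSeries.X ∣ f) :
    HahnSeries.single a 1 * HahnSeries.ofPowerSeries ℤ k f ∈ tO k (a + 1) := by
  obtain ⟨f, rfl⟩ := h
  refine mem_tO_iff_exists.2 ⟨f, ?_⟩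
  rw [map_mul, HahnSeries.ofPowerSeries_X, ← mul_assoc, HahnSeries.single_mul_single, one_mul]

theorem smul_mem_tO_succ {a : ℤ} {v : LaurentSeries k} (hv : v ∈ tO k a) {r : PowerSeries k}
    (hr : PowerSeries.X ∣ r) : r • v ∈ tO k (a + 1) := by
  obtain ⟨f, rfl⟩ := mem_tO_iff_exists.1 hv
  rw [Algebra.smul_def, mul_left_comm, LaurentSeries.coe_algebraMap, ← map_mul]
  exact single_mul_ofPowerSeries_mem_tO_succ (hr.mul_right f)

theorem integralEquiv_mem_iwahoriChain {M : (Matrix (Fin 2) (Fin 2) (PowerSeries k))ˣ}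
    (hM : PowerSeries.X ∣ M.1 0 1) {j : ℤ} {v : Fin 2 → LaurentSeries k}
    (hv : v ∈ iwahoriChain k j) : integralEquiv M v ∈ iwahoriChain k j := by
  rw [mem_iwahoriChain] at hv ⊢
  simp only [integralEquiv_apply, Fin.sum_univ_two]
  refine ⟨add_mem (Submodule.smul_mem _ _ hv.1)
      (tO_antitone (by omega) (smul_mem_tO_succ hv.2 hM)),
    add_mem (Submodule.smul_mem _ _ (tO_antitone (by omega) hv.1))
      (Submodule.smul_mem _ _ hv.2)⟩

theorem X_dvd_inv_apply {M : (Matrix (Fin 2) (Fin 2) (PowerSeries k))ˣ}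
    (hM : PowerSeries.X ∣ M.1 0 1) : PowerSeries.X ∣ M⁻¹.1 0 1 := by
  rw [Matrix.coe_units_inv, Matrix.inv_def, Matrix.adjugate_fin_two]
  simpa using hM

theorem integralEquiv_mem_iwahoriChain_iff {M : (Matrix (Fin 2) (Fin 2) (PowerSeries k))ˣ}
    (hM : PowerSeries.X ∣ M.1 0 1) {j : ℤ} {v : Fin 2 → LaurentSeries k} :
    integralEquiv M v ∈ iwahoriChain k j ↔ v ∈ iwahoriChain k j := by
  refine ⟨fun h => ?_, integralEquiv_mem_iwahoriChain hM⟩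
  have := integralEquiv_mem_iwahoriChain (X_dvd_inv_apply hM) h
  have hinv := integralEquiv_inv_apply M⁻¹ v
  rw [inv_inv] at hinv
  rwa [hinv] at this

theorem map_iwahoriChain {M : (Matrix (Fin 2) (Fin 2) (PowerSeries k))ˣ}
    (hM : PowerSeries.X ∣ M.1 0 1) (j : ℤ) :
    (iwahoriChain k j).map (integralEquiv M).toLinearMap = iwahoriChain k j := by
  ext v
  constructor
  · rintro ⟨u, hu, rfl⟩
    exact integralEquiv_mem_iwahoriChain hM hu
  · intro hv
    exact ⟨_, integralEquiv_mem_iwahoriChain (X_dvd_inv_apply hM) hv, integralEquiv_inv_apply M v⟩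

theorem notMem_tO_of_notMem_iwahoriChain_odd {n : ℤ} {v : Fin 2 → LaurentSeries k}
    (h : v ∈ iwahoriChain k (2 * n)) (h' : v ∉ iwahoriChain k (2 * n + 1)) :
    v 0 ∉ tO k (n + 1) := fun h0 => h' <| mem_iwahoriChain.2
  ⟨tO_antitone (by omega) h0, tO_antitone (by omega) (mem_iwahoriChain.1 h).2⟩

theorem notMem_tO_of_notMem_iwahoriChain_even {n : ℤ} {v : Fin 2 → LaurentSeries k}
    (h : v ∈ iwahoriChain k (2 * n + 1)) (h' : v ∉ iwahoriChain k (2 * n + 1 + 1)) :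
    v 1 ∉ tO k (n + 1) := fun h1 => h' <| mem_iwahoriChain.2
  ⟨tO_antitone (by omega) (mem_iwahoriChain.1 h).1, tO_antitone (by omega) h1⟩

theorem exists_eq_map_diagLat {Λ : Submodule (PowerSeries k) (Fin 2 → LaurentSeries k)}
    {a b : ℤ} {x y : Fin 2 → LaurentSeries k} (hx : x ∈ Λ) (hy : y ∈ Λ)
    (hxa : x ∈ iwahoriChain k (2 * a)) (hxa' : x ∉ iwahoriChain k (2 * a + 1))
    (hyb : y ∈ iwahoriChain k (2 * b + 1)) (hyb' : y ∉ iwahoriChain k (2 * b + 1 + 1))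
    (ha : ∀ v ∈ Λ, ∀ n, v ∈ iwahoriChain k (2 * n) → v ∉ iwahoriChain k (2 * n + 1) → a ≤ n)
    (hb : ∀ v ∈ Λ, ∀ n, v ∈ iwahoriChain k (2 * n + 1) → v ∉ iwahoriChain k (2 * n + 1 + 1) →
      b ≤ n) :
    ∃ M : (Matrix (Fin 2) (Fin 2) (PowerSeries k))ˣ, PowerSeries.X ∣ M.1 0 1 ∧
      Λ = (diagLat k ![a, b]).map (integralEquiv M).toLinearMap := by
  have hx0 := notMem_tO_of_notMem_iwahoriChain_odd hxa hxa'
  have hy1 := notMem_tO_of_notMem_iwahoriChain_even hyb hyb'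
  obtain ⟨m00, h00⟩ := mem_tO_iff_exists.1 (tO_antitone (by omega : a ≤ _)
    (mem_iwahoriChain.1 hxa).1)
  obtain ⟨m10, h10⟩ := mem_tO_iff_exists.1 (tO_antitone (by omega : a ≤ _)
    (mem_iwahoriChain.1 hxa).2)
  obtain ⟨d, h01⟩ := mem_tO_iff_exists.1 (tO_antitone (by omega : b + 1 ≤ _)
    (mem_iwahoriChain.1 hyb).1)
  obtain ⟨m11, h11⟩ := mem_tO_iff_exists.1 (tO_antitone (by omega : b ≤ _)
    (mem_iwahoriChain.1 hyb).2)
  have hc0 : PowerSeries.constantCoeff m00 ≠ 0 := fun h => hx0 <| by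
    rw [← h00]
    exact single_mul_ofPowerSeries_mem_tO_succ (PowerSeries.X_dvd_iff.2 h)
  have hc1 : PowerSeries.constantCoeff m11 ≠ 0 := fun h => hy1 <| by
    rw [← h11]
    exact single_mul_ofPowerSeries_mem_tO_succ (PowerSeries.X_dvd_iff.2 h)
  have h01' : HahnSeries.single b 1 * HahnSeries.ofPowerSeries ℤ k (PowerSeries.X * d) = y 0 := by
    rw [← h01, map_mul, HahnSeries.ofPowerSeries_X, ← mul_assoc, HahnSeries.single_mul_single,
      one_mul]
  have hdet : IsUnit (!![m00, PowerSeries.X * d; m10, m11] :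
      Matrix (Fin 2) (Fin 2) (PowerSeries k)) := by
    rw [Matrix.isUnit_iff_isUnit_det, Matrix.det_fin_two_of, PowerSeries.isUnit_iff_constantCoeff]
    simp [hc0, hc1]
  obtain ⟨M, hM⟩ := hdet
  have hX : PowerSeries.X ∣ M.1 0 1 := by simp [hM]
  have hg : ∀ w ∈ diagLat k ![a, b], integralEquiv M w ∈ Λ := by
    intro w hw
    obtain ⟨α, hα⟩ := mem_tO_iff_exists.1 (mem_diagLat.1 hw 0)
    obtain ⟨β, hβ⟩ := mem_tO_iff_exists.1 (mem_diagLat.1 hw 1)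
    have : integralEquiv M w = α • x + β • y := by
      ext1 i
      rw [integralEquiv_apply, Fin.sum_univ_two, hM, ← hα, ← hβ]
      fin_cases i
      · simp [Algebra.smul_def, LaurentSeries.coe_algebraMap, ← h00, ← h01']
        ring
      · simp [Algebra.smul_def, LaurentSeries.coe_algebraMap, ← h10, ← h11]
        ring
    rw [this]
    exact add_mem (Λ.smul_mem _ hx) (Λ.smul_mem _ hy)
  refine ⟨M, hX, le_antisymm (fun v hv => ?_) ?_⟩
  · classical
    obtain ⟨w, rfl⟩ := (integralEquiv M).surjective v
    let w' : Fin 2 → LaurentSeries k := fun i => if w i ∈ tO k (![a, b] i) then 0 else w i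
    have hsub : w - w' ∈ diagLat k ![a, b] := by
      refine mem_diagLat.2 fun i => ?_
      by_cases h : w i ∈ tO k (![a, b] i) <;> simp [w', h]
    have hw' : ∀ i c, ![a, b] i ≤ c → w' i ∈ tO k c → w' i = 0 := by
      intro i c hc h
      by_contra hne
      have hi : w i ∉ tO k (![a, b] i) := fun hi => hne (if_pos hi)
      rw [show w' i = w i from if_neg hi] at h
      exact hi (tO_antitone hc h)
    have hΛ : integralEquiv M w' ∈ Λ := by
      have := sub_mem hv (hg _ hsub)
      rwa [← map_sub, sub_sub_cancel] at this
    have hzero : w' = 0 := by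
      by_contra hne
      obtain ⟨j, hj, hj'⟩ := exists_mem_notMem_iwahoriChain hne
      have hgj := (integralEquiv_mem_iwahoriChain_iff hX).2 hj
      have hgj' := mt (integralEquiv_mem_iwahoriChain_iff hX).1 hj'
      obtain ⟨n, rfl | rfl⟩ := Int.even_or_odd' j
      · refine notMem_tO_of_notMem_iwahoriChain_odd hj hj' ?_
        rw [hw' 0 _ (ha _ hΛ n hgj hgj') (tO_antitone (by omega) (mem_iwahoriChain.1 hj).1)]
        exact zero_mem _
      · refine notMem_tO_of_notMem_iwahoriChain_even hj hj' ?_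
        rw [hw' 1 _ (hb _ hΛ n hgj hgj') (tO_antitone (by omega) (mem_iwahoriChain.1 hj).2)]
        exact zero_mem _
    rw [hzero, sub_zero] at hsub
    exact Submodule.mem_map_of_mem hsub
  · rintro _ ⟨w, hw, rfl⟩
    exact hg w hw

theorem IsLattice.exists_ne_zero {Λ : Submodule (PowerSeries k) (Fin 2 → LaurentSeries k)}
    (h : IsLattice Λ) : ∃ v ∈ Λ, v ≠ 0 := by
  by_contra! h0
  have hbot : Λ = ⊥ := (Submodule.eq_bot_iff _).2 h0
  have := h.2
  rw [hbot, Submodule.bot_coe, Submodule.span_zero_singleton] at this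
  exact bot_ne_top this

theorem iwahoriChain_two_mul (n : ℤ) : iwahoriChain k (2 * n) = diagLat k ![n, n] := by
  rw [iwahoriChain]
  congr <;> omega

theorem iwahoriChain_two_mul_add_one (n : ℤ) :
    iwahoriChain k (2 * n + 1) = diagLat k ![n + 1, n] := by
  rw [iwahoriChain]
  congr <;> omega

theorem stdLat_two : stdLat k 2 = iwahoriChain k 0 := by
  rw [stdLat, ← mul_zero 2, iwahoriChain_two_mul]
  congr
  ext i
  fin_cases i <;> rfl

theorem mulVec_mem_iff_between {m : ℕ}
    {Λ : Submodule (PowerSeries k) (Fin 2 → LaurentSeries k)} (hΛ : IsLattice Λ)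
    (h0 : relIdx Λ (stdLat k 2) = 0) :
    (∀ v ∈ Λ, (Matrix.of ![![0, HahnSeries.single ((m : ℤ) + 1) 1],
      ![HahnSeries.single (m : ℤ) 1, 0]]).mulVec v ∈ Λ) ↔
        iwahoriChain k m ≤ Λ ∧ Λ ≤ iwahoriChain k (-m) := by
  constructor
  swap
  · rintro ⟨h1, h2⟩ v hv
    exact h1 (iwahoriChain_antitone (by omega) ((mulVec_mem_iwahoriChain_iff rfl).2 (h2 hv)))
  intro hγ
  obtain ⟨N, hN⟩ := exists_le_iwahoriChain hΛ.1
  have hbound : ∀ v ∈ Λ, ∀ j, v ∉ iwahoriChain k (j + 1) → N ≤ j := fun v hv j hj => by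
    by_contra h
    exact hj (iwahoriChain_antitone (by omega) (hN hv))
  have hshift : ∀ v ∈ Λ, ∀ j, v ∈ iwahoriChain k j → v ∉ iwahoriChain k (j + 1) →
      ∃ u ∈ Λ, u ∈ iwahoriChain k (j + 2 * m + 1) ∧ u ∉ iwahoriChain k (j + 2 * m + 1 + 1) :=
    fun v hv j h h' => ⟨_, hγ v hv, (mulVec_mem_iwahoriChain_iff rfl).2 h,
      mt (mulVec_mem_iwahoriChain_iff (by ring)).1 h'⟩
  let P : ℤ → Prop := fun j =>
    ∃ v ∈ Λ, v ∈ iwahoriChain k j ∧ v ∉ iwahoriChain k (j + 1)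
  have hP : ∀ j, P j → P (j + 2 * m + 1) := fun j ⟨v, hv, h, h'⟩ => hshift v hv j h h'
  have hPN : ∀ j, P j → N ≤ j := fun j ⟨v, hv, _, h'⟩ => hbound v hv j h'
  obtain ⟨v, hv, hv0⟩ := hΛ.exists_ne_zero
  obtain ⟨j, hj, hj'⟩ := exists_mem_notMem_iwahoriChain hv0
  have hPj : P j := ⟨v, hv, hj, hj'⟩
  have hex : (∃ n, P (2 * n)) ∧ ∃ n, P (2 * n + 1) := by
    obtain ⟨n, rfl | rfl⟩ := Int.even_or_odd' j
    · exact ⟨⟨n, hPj⟩, n + m, by convert hP _ hPj using 1; ring⟩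
    · exact ⟨⟨n + m + 1, by convert hP _ hPj using 1; ring⟩, n, hPj⟩
  obtain ⟨a, ⟨x, hx, hxa, hxa'⟩, ha⟩ := Int.exists_least_of_bdd (P := fun n => P (2 * n))
    ⟨min N 0, fun z hz => by have := hPN _ hz; omega⟩ hex.1
  obtain ⟨b, ⟨y, hy, hyb, hyb'⟩, hb⟩ := Int.exists_least_of_bdd (P := fun n => P (2 * n + 1))
    ⟨min N 0 - 1, fun z hz => by have := hPN _ hz; omega⟩ hex.2
  have hba : b ≤ a + m := hb _ (by convert hP _ ⟨x, hx, hxa, hxa'⟩ using 1; ring)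
  have hab : a ≤ b + m + 1 := ha _ (by convert hP _ ⟨y, hy, hyb, hyb'⟩ using 1; ring)
  obtain ⟨M, hM, rfl⟩ := exists_eq_map_diagLat hx hy hxa hxa' hyb hyb'
    (fun v hv n h h' => ha n ⟨v, hv, h, h'⟩) (fun v hv n h h' => hb n ⟨v, hv, h, h'⟩)
  rw [stdLat_two, ← map_iwahoriChain hM 0, iwahoriChain, relIdx_map_diagLat] at h0
  simp [Fin.sum_univ_two] at h0
  rw [← map_iwahoriChain hM m, ← map_iwahoriChain hM (-m)]
  refine ⟨Submodule.map_mono (diagLat_mono ?_), Submodule.map_mono (diagLat_mono ?_)⟩ <;>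
  · rw [Pi.le_def, Fin.forall_fin_two]
    simp only [Matrix.cons_val_zero, Matrix.cons_val_one]
    omega

end Auxiliary

theorem stmt6 (k : Type) [Field k] (m : ℕ)
    (γ : Matrix (Fin 2) (Fin 2) (LaurentSeries k))
    (hγ : γ = Matrix.of ![![0, HahnSeries.single ((m : ℤ) + 1) 1],
      ![HahnSeries.single (m : ℤ) 1, 0]])
    (Λ : Submodule (PowerSeries k) (Fin 2 → LaurentSeries k))
    (hΛ : IsLattice Λ) (h0 : relIdx Λ (stdLat k 2) = 0) :
    (∀ p : ℕ, m = 2 * p →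
      ((∀ v ∈ Λ, γ.mulVec v ∈ Λ) ↔
        diagLat k ![(p : ℤ), (p : ℤ)] ≤ Λ ∧ Λ ≤ diagLat k ![-(p : ℤ), -(p : ℤ)])) ∧
    (∀ p : ℕ, m = 2 * p + 1 →
      ((∀ v ∈ Λ, γ.mulVec v ∈ Λ) ↔
        diagLat k ![(p : ℤ) + 1, (p : ℤ)] ≤ Λ ∧
          Λ ≤ diagLat k ![-(p : ℤ), -((p : ℤ) + 1)])) := by
  subst hγ
  refine ⟨fun p hp => ?_, fun p hp => ?_⟩ <;> rw [mulVec_mem_iff_between hΛ h0]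
  · rw [← iwahoriChain_two_mul, ← iwahoriChain_two_mul, hp]
    push_cast
    rw [mul_neg]
  · rw [← iwahoriChain_two_mul_add_one, hp,
      show (-(p : ℤ)) = -((p : ℤ) + 1) + 1 by ring, ← iwahoriChain_two_mul_add_one]
    push_cast
    rw [show -(2 * (p : ℤ) + 1) = 2 * -((p : ℤ) + 1) + 1 by ring]
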